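/- arXiv:1808.04120 — 2 statements merged into one kernel-verified Lean document; each statement's English description precedes it below -/
import Mathlib

section
/- Let n ≥ 2 and let 1 ≤ ℓ < k ≤ n. The function f(λ) := − (C(n,ℓ)⁻¹ σ_ℓ(λ)) / (C(n,k)⁻¹ σ_k(λ)) is well defined and smooth on the cone Γ_k (since σ_k > 0 there), is concave on Γ_k, and satisfies ∂f/∂λᵢ > 0 on Γ_k for every i = 1,…,n. -/
/-- The `k`-th elementary symmetric polynomial `σ_k` on `ℝⁿ`. -/
noncomputable def esymm (n k : ℕ) (x : Fin n → ℝ) : ℝ :=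
  ∑ s ∈ Finset.powersetCard k (Finset.univ : Finset (Fin n)), ∏ i ∈ s, x i

/-- The standard `k`-positive cone `Γ_k = {x ∈ ℝⁿ : σ₁(x) > 0, …, σ_k(x) > 0}`. -/
def gammaCone (n k : ℕ) : Set (Fin n → ℝ) :=
  {x | ∀ j : ℕ, 1 ≤ j → j ≤ k → 0 < esymm n j x}

open Polynomial in
/-- Over `ℝ`, the derivative of a polynomial with only real roots has only real roots. -/
theorem Polynomial.Splits.derivative_real {p : ℝ[X]} (hp : p.Splits) :
    (derivative p).Splits := by
  rcases Nat.eq_zero_or_pos p.natDegree with h0 | hpos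
  · rw [derivative_of_natDegree_zero h0]
    exact Splits.zero
  · have h1 := card_roots_le_derivative p
    have h2 := natDegree_derivative_le p
    have h3 := card_roots' (derivative p)
    rw [splits_iff_card_roots] at hp ⊢
    omega

open Polynomial in
/-- Laguerre's inequality for real-rooted polynomials. -/
theorem Polynomial.Splits.laguerre_inequality {p : ℝ[X]} (hp : p.Splits) (t : ℝ) :
    p.eval t * (derivative (derivative p)).eval t ≤ (derivative p).eval t ^ 2 := by
  induction hp using Submonoid.closure_induction with
  | mem p hp =>
    rcases hp with ⟨a, rfl⟩ | ⟨a, rfl⟩ <;> simp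
  | one => simp
  | mul p q _ _ hp hq =>
    simp only [derivative_mul, derivative_add, eval_mul, eval_add]
    nlinarith [mul_le_mul_of_nonneg_left hp (sq_nonneg (q.eval t)),
      mul_le_mul_of_nonneg_left hq (sq_nonneg (p.eval t))]

open Polynomial in
/-- Newton's inequality for the coefficients of a real-rooted polynomial. -/
theorem Polynomial.Splits.newton_inequality {p : ℝ[X]} (hp : p.Splits) (j : ℕ) :
    (j + 2) * (p.coeff j * p.coeff (j + 2)) ≤ (j + 1) * p.coeff (j + 1) ^ 2 := by
  have hs : ∀ m : ℕ, (derivative^[m] p).Splits := by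
    intro m
    induction m with
    | zero => exact hp
    | succ m ih =>
      rw [Function.iterate_succ_apply']
      exact ih.derivative_real
  have hc : ∀ m : ℕ, (derivative^[m] p).eval 0 = m.factorial * p.coeff m := by
    intro m
    rw [← coeff_zero_eq_eval_zero, coeff_iterate_derivative]
    simp [Nat.descFactorial_self]
  have h := (hs j).laguerre_inequality 0
  rw [← Function.iterate_succ_apply' derivative, ← Function.iterate_succ_apply' derivative,
    hc, hc, hc, Nat.factorial_succ (j + 1), Nat.factorial_succ j] at h
  push_cast at h
  have hf : (0 : ℝ) < (j.factorial : ℝ) ^ 2 * (j + 1) := by positivity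
  refine le_of_mul_le_mul_left ?_ hf
  linarith

section ElementarySymmetric

variable {ι : Type*}

open Polynomial in
/-- The `k`-th elementary symmetric polynomial in the variables `x i`, `i ∈ s`, as a coefficient
of the generating polynomial `∏ i ∈ s, (1 + x i * X)`. -/
noncomputable def esymmOn (s : Finset ι) (k : ℕ) (x : ι → ℝ) : ℝ :=
  (∏ i ∈ s, (1 + C (x i) * X) : ℝ[X]).coeff k

open Polynomial in
theorem esymmOn_eq_sum (s : Finset ι) (k : ℕ) (x : ι → ℝ) :
    esymmOn s k x = ∑ t ∈ s.powersetCard k, ∏ i ∈ t, x i := by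
  classical
  rw [esymmOn, Finset.prod_one_add, finsetSum_coeff, Finset.powersetCard_eq_filter,
    Finset.sum_filter]
  refine Finset.sum_congr rfl fun t _ => ?_
  rw [Finset.prod_mul_distrib, Finset.prod_const, ← map_prod, coeff_C_mul_X_pow]
  simp [eq_comm]

theorem esymmOn_zero (s : Finset ι) (x : ι → ℝ) : esymmOn s 0 x = 1 := by
  simp [esymmOn_eq_sum]

theorem esymmOn_smul (s : Finset ι) (k : ℕ) (a : ℝ) (x : ι → ℝ) :
    esymmOn s k (a • x) = a ^ k * esymmOn s k x := by
  rw [esymmOn_eq_sum, esymmOn_eq_sum, Finset.mul_sum]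
  refine Finset.sum_congr rfl fun t ht => ?_
  simp [Finset.prod_mul_distrib, (Finset.mem_powersetCard.1 ht).2]

theorem esymmOn_congr {s : Finset ι} (k : ℕ) {x y : ι → ℝ} (h : ∀ i ∈ s, x i = y i) :
    esymmOn s k x = esymmOn s k y := by
  rw [esymmOn, esymmOn, Finset.prod_congr rfl fun i hi => by rw [h i hi]]

open Polynomial in
theorem esymmOn_succ [DecidableEq ι] {s : Finset ι} {i : ι} (hi : i ∈ s) (k : ℕ) (x : ι → ℝ) :
    esymmOn s (k + 1) x = esymmOn (s.erase i) (k + 1) x + x i * esymmOn (s.erase i) k x := by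
  rw [esymmOn, ← Finset.mul_prod_erase s _ hi, add_mul, one_mul, coeff_add, mul_assoc,
    coeff_C_mul, coeff_X_mul]
  rfl

open Polynomial in
theorem succ_mul_esymmOn_succ [DecidableEq ι] (s : Finset ι) (k : ℕ) (x : ι → ℝ) :
    (k + 1) * esymmOn s (k + 1) x = ∑ i ∈ s, x i * esymmOn (s.erase i) k x := by
  have h := congrArg (fun p : ℝ[X] => p.coeff k)
    (derivative_prod_finset (s := s) (f := fun i => (1 + C (x i) * X : ℝ[X])))
  simp only [coeff_derivative, finsetSum_coeff, derivative_add, derivative_one, derivative_mul,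
    derivative_C, derivative_X, zero_mul, zero_add, mul_one, coeff_mul_C] at h
  rw [mul_comm, esymmOn, h]
  exact Finset.sum_congr rfl fun i _ => mul_comm _ _

open Polynomial in
/-- Newton's inequality for elementary symmetric polynomials. -/
theorem esymmOn_newton (s : Finset ι) (j : ℕ) (x : ι → ℝ) :
    (j + 2) * (esymmOn s j x * esymmOn s (j + 2) x) ≤ (j + 1) * esymmOn s (j + 1) x ^ 2 := by
  refine Splits.newton_inequality (Splits.prod fun i _ => Splits.of_natDegree_le_one ?_) j
  rw [add_comm]
  exact natDegree_linear_le

theorem esymmOn_mul_lt_sq {s : Finset ι} {j : ℕ} {x : ι → ℝ}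
    (h1 : 0 < esymmOn s (j + 1) x) :
    esymmOn s j x * esymmOn s (j + 2) x < esymmOn s (j + 1) x ^ 2 := by
  have hN := esymmOn_newton s j x
  have h2 : 0 < esymmOn s (j + 1) x ^ 2 := by positivity
  have hj : (0 : ℝ) ≤ j := j.cast_nonneg
  by_contra! hle
  nlinarith [mul_le_mul_of_nonneg_left hle (by positivity : (0 : ℝ) ≤ j + 2)]

theorem esymmOn_mul_lt_mul {s : Finset ι} {l m : ℕ} {x : ι → ℝ} (hlm : l + 1 ≤ m)
    (hx : ∀ j ≤ m, 0 < esymmOn s j x) :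
    esymmOn s l x * esymmOn s (m + 1) x < esymmOn s (l + 1) x * esymmOn s m x := by
  induction m, hlm using Nat.le_induction with
  | base =>
    rw [← sq]
    exact esymmOn_mul_lt_sq (hx _ le_rfl)
  | succ m hlm ih =>
    have h := ih fun j hj => hx j (by omega)
    have hm := hx m (by omega)
    have hm' := hx (m + 1) le_rfl
    have hN := esymmOn_mul_lt_sq hm'
    refine lt_of_mul_lt_mul_left ?_ hm.le
    nlinarith [mul_lt_mul_of_pos_left hN (hx l (by omega)), mul_lt_mul_of_pos_right h hm']

/-- Deleting a variable maps the `k + 1`-positive cone into the `k`-positive cone. -/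
theorem esymmOn_erase_pos [DecidableEq ι] {s : Finset ι} {i : ι} (hi : i ∈ s) {x : ι → ℝ} {k : ℕ}
    (hx : ∀ j ≤ k + 1, 0 < esymmOn s j x) : ∀ j ≤ k, 0 < esymmOn (s.erase i) j x := by
  intro j
  induction j with
  | zero => simp [esymmOn_zero]
  | succ j ih =>
    intro hj
    have h0 := ih (by omega)
    have h1 := hx (j + 1) (by omega)
    have h2 := hx (j + 2) (by omega)
    rw [esymmOn_succ hi] at h1 h2
    have hN := esymmOn_newton (s.erase i) j x
    have hj0 : (0 : ℝ) ≤ j := j.cast_nonneg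
    generalize esymmOn (s.erase i) j x = a at *
    generalize esymmOn (s.erase i) (j + 1) x = b at *
    generalize esymmOn (s.erase i) (j + 2) x = c at *
    by_contra! hb
    have hac : b ^ 2 < a * c := by
      nlinarith [mul_pos h0 h2, mul_nonneg (neg_nonneg.2 hb) h1.le]
    nlinarith [mul_lt_mul_of_pos_left hac (by positivity : (0 : ℝ) < j + 2), sq_nonneg b]

theorem sub_sq_div_add_le {a b A B D : ℝ} (hA : 0 < A) (hB : 0 < B) (hD : A + B ≤ D) :
    (a - a ^ 2 / A) + (b - b ^ 2 / B) ≤ (a + b) - (a + b) ^ 2 / D := by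
  have h1 : (a + b) ^ 2 / D ≤ (a + b) ^ 2 / (A + B) := by gcongr
  have h2 : (a + b) ^ 2 / (A + B) ≤ a ^ 2 / A + b ^ 2 / B := by
    rw [div_add_div _ _ hA.ne' hB.ne', div_le_div_iff₀ (by positivity) (by positivity)]
    nlinarith [mul_nonneg (mul_pos hA hB).le (sq_nonneg (a * B - b * A))]
  linarith

/-- The positive cone is closed under addition, and the quotient of consecutive elementary
symmetric polynomials is superadditive on it. -/
theorem esymmOn_add (k : ℕ) : ∀ (s : Finset ι) (x y : ι → ℝ),
    (∀ j ≤ k + 1, 0 < esymmOn s j x) → (∀ j ≤ k + 1, 0 < esymmOn s j y) →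
    (∀ j ≤ k + 1, 0 < esymmOn s j (x + y)) ∧
      esymmOn s (k + 1) x / esymmOn s k x + esymmOn s (k + 1) y / esymmOn s k y ≤
        esymmOn s (k + 1) (x + y) / esymmOn s k (x + y) := by
  classical
  induction k with
  | zero =>
    intro s x y hx hy
    have h1 : ∀ z : ι → ℝ, esymmOn s 1 z = ∑ i ∈ s, z i := fun z => by
      simpa [esymmOn_zero] using succ_mul_esymmOn_succ s 0 z
    have hadd : esymmOn s 1 (x + y) = esymmOn s 1 x + esymmOn s 1 y := by
      simp [h1, Finset.sum_add_distrib]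
    refine ⟨fun j hj => ?_, ?_⟩
    · interval_cases j
      · simp [esymmOn_zero]
      · rw [hadd]
        exact add_pos (hx 1 le_rfl) (hy 1 le_rfl)
    · simp [esymmOn_zero, hadd]
  | succ k ih =>
    intro s x y hx hy
    have hxy := (ih s x y (fun j hj => hx j (by omega)) (fun j hj => hy j (by omega))).1
    have hquot : ∀ z : ι → ℝ, (∀ j ≤ k + 1, 0 < esymmOn s j z) →
        (∀ i ∈ s, 0 < esymmOn (s.erase i) k z) →
        (k + 2) * (esymmOn s (k + 2) z / esymmOn s (k + 1) z) =
          ∑ i ∈ s, (z i - z i ^ 2 / (esymmOn s (k + 1) z / esymmOn (s.erase i) k z)) := by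
      intro z hz hzi
      have h := succ_mul_esymmOn_succ s (k + 1) z
      push_cast at h
      rw [← mul_div_assoc, show (k + 2 : ℝ) = k + 1 + 1 by ring, h, Finset.sum_div]
      refine Finset.sum_congr rfl fun i hi => ?_
      have hp := hz (k + 1) le_rfl
      have hpi := hzi i hi
      have hs := esymmOn_succ hi k z
      field_simp
      rw [hs]
      ring
    have herase : ∀ i ∈ s, ∀ z : ι → ℝ, (∀ j ≤ k + 2, 0 < esymmOn s j z) →
        ∀ j ≤ k + 1, 0 < esymmOn (s.erase i) j z := fun i hi z hz => esymmOn_erase_pos hi hz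
    have hi_add := fun i (hi : i ∈ s) =>
      ih (s.erase i) x y (herase i hi x hx) (herase i hi y hy)
    have hle : esymmOn s (k + 2) x / esymmOn s (k + 1) x +
        esymmOn s (k + 2) y / esymmOn s (k + 1) y ≤
        esymmOn s (k + 2) (x + y) / esymmOn s (k + 1) (x + y) := by
      refine le_of_mul_le_mul_left ?_ (by positivity : (0 : ℝ) < k + 2)
      rw [mul_add, hquot x (fun j hj => hx j (by omega))
          (fun i hi => herase i hi x hx k (by omega)),
        hquot y (fun j hj => hy j (by omega)) (fun i hi => herase i hi y hy k (by omega)),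
        hquot (x + y) hxy (fun i hi => (hi_add i hi).1 k (by omega)), ← Finset.sum_add_distrib]
      refine Finset.sum_le_sum fun i hi => ?_
      have hxi := herase i hi x hx k (by omega)
      have hyi := herase i hi y hy k (by omega)
      have hxyi := (hi_add i hi).1 k (by omega)
      refine sub_sq_div_add_le (div_pos (hx _ (by omega)) hxi) (div_pos (hy _ (by omega)) hyi) ?_
      have hd : ∀ z : ι → ℝ, 0 < esymmOn (s.erase i) k z →
          esymmOn s (k + 1) z / esymmOn (s.erase i) k z =
            esymmOn (s.erase i) (k + 1) z / esymmOn (s.erase i) k z + z i := by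
        intro z hz
        rw [esymmOn_succ hi, add_div, mul_div_assoc, div_self hz.ne', mul_one]
      rw [hd x hxi, hd y hyi, hd (x + y) hxyi, Pi.add_apply]
      linarith [(hi_add i hi).2]
    refine ⟨fun j hj => ?_, hle⟩
    rcases Nat.lt_or_ge j (k + 2) with hj' | hj'
    · exact hxy j (by omega)
    · obtain rfl : j = k + 2 := by omega
      have hpos : 0 < esymmOn s (k + 2) (x + y) / esymmOn s (k + 1) (x + y) :=
        lt_of_lt_of_le (add_pos (div_pos (hx _ le_rfl) (hx _ (by omega)))
          (div_pos (hy _ le_rfl) (hy _ (by omega)))) hle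
      exact (div_pos_iff_of_pos_right (hxy _ le_rfl)).1 hpos

/-- The cone on which the elementary symmetric polynomials of degree at most `k` are positive. -/
def posCone (s : Finset ι) (k : ℕ) : Set (ι → ℝ) :=
  {x | ∀ j ≤ k, 0 < esymmOn s j x}

theorem posCone_anti (s : Finset ι) {k l : ℕ} (h : k ≤ l) : posCone s l ⊆ posCone s k :=
  fun _ hx j hj => hx j (hj.trans h)

theorem smul_mem_posCone {s : Finset ι} {k : ℕ} {x : ι → ℝ} (hx : x ∈ posCone s k) {a : ℝ}
    (ha : 0 < a) : a • x ∈ posCone s k := fun j hj => by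
  rw [esymmOn_smul]
  exact mul_pos (pow_pos ha j) (hx j hj)

theorem convex_posCone (s : Finset ι) (k : ℕ) : Convex ℝ (posCone s k) := by
  rw [convex_iff_forall_pos]
  intro x hx y hy a b ha hb _
  cases k with
  | zero =>
    intro j hj
    obtain rfl : j = 0 := by omega
    simp [esymmOn_zero]
  | succ k =>
    exact (esymmOn_add k s _ _ (smul_mem_posCone hx ha) (smul_mem_posCone hy hb)).1

theorem concaveOn_esymmOn_div (s : Finset ι) (k : ℕ) :
    ConcaveOn ℝ (posCone s (k + 1)) (fun x => esymmOn s (k + 1) x / esymmOn s k x) := by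
  rw [concaveOn_iff_forall_pos]
  refine ⟨convex_posCone s _, fun x hx y hy a b ha hb _ => ?_⟩
  have h := (esymmOn_add k s _ _ (smul_mem_posCone hx ha) (smul_mem_posCone hy hb)).2
  have hd : ∀ (c : ℝ), 0 < c → ∀ z : ι → ℝ, esymmOn s (k + 1) (c • z) / esymmOn s k (c • z) =
      c • (esymmOn s (k + 1) z / esymmOn s k z) := by
    intro c hc z
    rw [esymmOn_smul, esymmOn_smul, pow_succ, mul_assoc, mul_div_mul_left _ _ (pow_pos hc k).ne',
      mul_div_assoc, smul_eq_mul]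
  rwa [hd a ha, hd b hb] at h

theorem ConcaveOn.log {E : Type*} [AddCommMonoid E] [Module ℝ E] {S : Set E} {f : E → ℝ}
    (hf : ConcaveOn ℝ S f) (hpos : ∀ x ∈ S, 0 < f x) :
    ConcaveOn ℝ S (fun x => Real.log (f x)) := by
  refine ⟨hf.1, fun x hx y hy a b ha hb hab => ?_⟩
  have h := strictConcaveOn_log_Ioi.concaveOn
  exact (h.2 (hpos x hx) (hpos y hy) ha hb hab).trans
    (Real.log_le_log (h.1 (hpos x hx) (hpos y hy) ha hb hab) (hf.2 hx hy ha hb hab))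

theorem ConvexOn.exp {E : Type*} [AddCommMonoid E] [Module ℝ E] {S : Set E} {f : E → ℝ}
    (hf : ConvexOn ℝ S f) : ConvexOn ℝ S (fun x => Real.exp (f x)) := by
  refine ⟨hf.1, fun x hx y hy a b ha hb hab => ?_⟩
  exact (Real.exp_le_exp.2 (hf.2 hx hy ha hb hab)).trans
    (convexOn_exp.2 (Set.mem_univ _) (Set.mem_univ _) ha hb hab)

theorem concaveOn_log_esymmOn_div (s : Finset ι) {l k : ℕ} (hlk : l ≤ k) :
    ConcaveOn ℝ (posCone s k) (fun x => Real.log (esymmOn s k x / esymmOn s l x)) := by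
  induction k, hlk using Nat.le_induction with
  | base =>
    refine (concaveOn_const (0 : ℝ) (convex_posCone s l)).congr fun x hx => ?_
    simp [div_self (hx l le_rfl).ne']
  | succ k hlk ih =>
    have h1 := (concaveOn_esymmOn_div s k).log
      fun x hx => div_pos (hx _ le_rfl) (hx _ (by omega))
    have h2 := ih.subset (posCone_anti s k.le_succ) (convex_posCone s _)
    refine (h1.add h2).congr fun x hx => ?_
    have hk := hx k (by omega)
    have hl := hx l (by omega)
    have hk' := hx (k + 1) le_rfl
    simp only [Pi.add_apply]
    rw [← Real.log_mul (div_pos hk' hk).ne' (div_pos hk hl).ne', div_mul_div_cancel₀ hk.ne']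

theorem convexOn_esymmOn_div (s : Finset ι) {l k : ℕ} (hlk : l ≤ k) :
    ConvexOn ℝ (posCone s k) (fun x => esymmOn s l x / esymmOn s k x) := by
  refine (concaveOn_log_esymmOn_div s hlk).neg.exp.congr fun x hx => ?_
  have hl := hx l hlk
  have hk := hx k le_rfl
  simp only [Pi.neg_apply]
  rw [← Real.log_inv, inv_div, Real.exp_log (div_pos hl hk)]

theorem contDiff_esymmOn [Fintype ι] (s : Finset ι) (k : ℕ) {m : WithTop ℕ∞} :
    ContDiff ℝ m (esymmOn s k) := by
  have h : esymmOn s k = fun x : ι → ℝ => ∑ t ∈ s.powersetCard k, ∏ i ∈ t, x i :=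
    funext fun x => esymmOn_eq_sum s k x
  rw [h]
  fun_prop

theorem esymmOn_add_smul_single [DecidableEq ι] {s : Finset ι} {i : ι} (hi : i ∈ s) (k : ℕ)
    (x : ι → ℝ) (t : ℝ) :
    esymmOn s (k + 1) (x + t • Pi.single i 1) =
      esymmOn s (k + 1) x + t * esymmOn (s.erase i) k x := by
  have h : ∀ j, esymmOn (s.erase i) j (x + t • Pi.single i 1) = esymmOn (s.erase i) j x :=
    fun j => esymmOn_congr j fun a ha => by simp [Finset.ne_of_mem_erase ha]
  rw [esymmOn_succ hi, esymmOn_succ hi, h, h]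
  simp
  ring

end ElementarySymmetric

theorem esymm_eq_esymmOn (n k : ℕ) : esymm n k = esymmOn (Finset.univ : Finset (Fin n)) k :=
  funext fun x => (esymmOn_eq_sum _ k x).symm

theorem gammaCone_eq_posCone (n k : ℕ) :
    gammaCone n k = posCone (Finset.univ : Finset (Fin n)) k := by
  ext x
  simp only [gammaCone, posCone, Set.mem_ofPred_eq, esymm_eq_esymmOn]
  refine ⟨fun h j hj => ?_, fun h j _ hj => h j hj⟩
  rcases Nat.eq_zero_or_pos j with rfl | hj0
  · simp [esymmOn_zero]
  · exact h j hj0 hj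

/-- Let `n ≥ 2` and `1 ≤ ℓ < k ≤ n`.  The Hessian-quotient function
`f(λ) = −(C(n,ℓ)⁻¹ σ_ℓ(λ))/(C(n,k)⁻¹ σ_k(λ))` is well defined (since `σ_k > 0` on `Γ_k`)
and smooth on `Γ_k`, concave on `Γ_k`, and has positive partial derivatives on `Γ_k`. -/
theorem stmt_13 (n k ℓ : ℕ) (hn : 2 ≤ n) (hℓ : 1 ≤ ℓ) (hℓk : ℓ < k) (hk : k ≤ n) :
    (∀ x ∈ gammaCone n k, 0 < esymm n k x) ∧
    ContDiffOn ℝ (⊤ : ℕ∞)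
      (fun x : Fin n → ℝ =>
        -(((n.choose ℓ : ℝ))⁻¹ * esymm n ℓ x / (((n.choose k : ℝ))⁻¹ * esymm n k x)))
      (gammaCone n k) ∧
    ConcaveOn ℝ (gammaCone n k)
      (fun x : Fin n → ℝ =>
        -(((n.choose ℓ : ℝ))⁻¹ * esymm n ℓ x / (((n.choose k : ℝ))⁻¹ * esymm n k x))) ∧
    ∀ x ∈ gammaCone n k, ∀ i : Fin n,
      0 < fderiv ℝ
        (fun x : Fin n → ℝ =>
          -(((n.choose ℓ : ℝ))⁻¹ * esymm n ℓ x / (((n.choose k : ℝ))⁻¹ * esymm n k x)))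
        x (Pi.single i 1) := by
  have hcℓ : (0 : ℝ) < (n.choose ℓ : ℝ)⁻¹ :=
    inv_pos.2 (Nat.cast_pos.2 (Nat.choose_pos (by omega)))
  have hck : (0 : ℝ) < (n.choose k : ℝ)⁻¹ := inv_pos.2 (Nat.cast_pos.2 (Nat.choose_pos hk))
  generalize (n.choose ℓ : ℝ)⁻¹ = c at *
  generalize (n.choose k : ℝ)⁻¹ = d at *
  rw [gammaCone_eq_posCone, esymm_eq_esymmOn, esymm_eq_esymmOn]
  refine ⟨fun x hx => hx k le_rfl, ?_, ?_, fun x hx i => ?_⟩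
  · exact ((contDiff_const.mul (contDiff_esymmOn _ ℓ)).contDiffOn.div
      (contDiff_const.mul (contDiff_esymmOn _ k)).contDiffOn
      fun x (hx : x ∈ posCone _ k) => (mul_pos hck (hx k le_rfl)).ne').neg
  · refine ((convexOn_esymmOn_div Finset.univ hℓk.le).smul (div_pos hcℓ hck).le).neg.congr
      fun x hx => ?_
    simp only [Pi.neg_apply, smul_eq_mul]
    rw [div_mul_div_comm]
  · obtain ⟨l, rfl⟩ : ∃ l, ℓ = l + 1 := ⟨ℓ - 1, by omega⟩
    obtain ⟨m, rfl⟩ : ∃ m, k = m + 1 := ⟨k - 1, by omega⟩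
    have hi := Finset.mem_univ i
    have hline : ∀ j, HasDerivAt (fun t : ℝ => esymmOn Finset.univ (j + 1) (x + t • Pi.single i 1))
        (esymmOn (Finset.univ.erase i) j x) 0 := fun j => by
      simp only [esymmOn_add_smul_single hi]
      simpa using ((hasDerivAt_id (0 : ℝ)).mul_const (esymmOn (Finset.univ.erase i) j x)).const_add
        (esymmOn Finset.univ (j + 1) x)
    have hpos := hx (m + 1) le_rfl
    have hd : DifferentiableAt ℝ (fun x : Fin n → ℝ => -(c * esymmOn Finset.univ (l + 1) x /
        (d * esymmOn Finset.univ (m + 1) x))) x :=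
      (((contDiff_const.mul (contDiff_esymmOn _ _)).contDiffAt.div
        (contDiff_const.mul (contDiff_esymmOn _ _)).contDiffAt
        (mul_pos hck hpos).ne').neg (n := 1)).differentiableAt one_ne_zero
    have hderiv := (((hline l).const_mul c).fun_div ((hline m).const_mul d)
      (by simpa using (mul_pos hck hpos).ne')).fun_neg
    rw [← hd.lineDeriv_eq_fderiv, lineDeriv, hderiv.deriv, zero_smul, add_zero, neg_pos]
    refine div_neg_of_neg_of_pos ?_ (pow_pos (mul_pos hck hpos) 2)
    have hlt := esymmOn_mul_lt_mul (by omega : l + 1 ≤ m) (esymmOn_erase_pos hi hx)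
    rw [esymmOn_succ hi, esymmOn_succ hi]
    nlinarith [mul_lt_mul_of_pos_left hlt (mul_pos hcℓ hck)]
end

section
/- Let Γ ⊆ ℝⁿ be an open set invariant under permutations of coordinates and let f : Γ → ℝ be a smooth symmetric function. Then the spectral function F defined by F(A) := f(λ₁(A),…,λₙ(A)) is a smooth function on the open set of Hermitian n×n matrices A whose eigenvalue vector λ(A) lies in Γ. -/
attribute [local instance] Matrix.normedAddCommGroup Matrix.normedSpace

/-- The eigenvalue vector of a Hermitian matrix, viewed as an element of the real vector
space `selfAdjoint.submodule ℝ (Matrix (Fin n) (Fin n) ℂ)` of Hermitian matrices. -/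
noncomputable def hermEigenvalues (n : ℕ)
    (A : selfAdjoint.submodule ℝ (Matrix (Fin n) (Fin n) ℂ)) : Fin n → ℝ :=
  (show (A : Matrix (Fin n) (Fin n) ℂ).IsHermitian from A.2).eigenvalues

section
open scoped ContDiff Topology
open MeasureTheory

section
variable {V 𝓐 : Type} [NormedAddCommGroup V] [NormedSpace ℝ V]

theorem norm_iteratedFDeriv_mul_le_geometric [NormedRing 𝓐] [NormedAlgebra ℝ 𝓐] {f g : V → 𝓐}
    (hf : ContDiff ℝ ∞ f) (hg : ContDiff ℝ ∞ g) {x : V} {N : ℕ} {a b R S : ℝ}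
    (hfx : ∀ i ≤ N, ‖iteratedFDeriv ℝ i f x‖ ≤ a * R ^ i)
    (hgx : ∀ i ≤ N, ‖iteratedFDeriv ℝ i g x‖ ≤ b * S ^ i) {i : ℕ} (hi : i ≤ N) :
    ‖iteratedFDeriv ℝ i (fun y => f y * g y) x‖ ≤ a * b * (R + S) ^ i := by
  refine (norm_iteratedFDeriv_mul_le hf hg x (mod_cast le_top)).trans ?_
  rw [add_pow, Finset.mul_sum]
  refine Finset.sum_le_sum fun k hk => ?_
  have hk' : k ≤ i := by simpa [Nat.lt_succ_iff] using hk
  calc (i.choose k : ℝ) * ‖iteratedFDeriv ℝ k f x‖ * ‖iteratedFDeriv ℝ (i - k) g x‖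
      = (i.choose k : ℝ) * (‖iteratedFDeriv ℝ k f x‖ * ‖iteratedFDeriv ℝ (i - k) g x‖) := by ring
    _ ≤ (i.choose k : ℝ) * ((a * R ^ k) * (b * S ^ (i - k))) := by
        gcongr
        · exact (norm_nonneg _).trans (hfx k (hk'.trans hi))
        · exact hfx k (hk'.trans hi)
        · exact hgx (i - k) (by omega)
    _ = a * b * (R ^ k * S ^ (i - k) * (i.choose k : ℝ)) := by ring

theorem norm_iteratedFDeriv_pow_succ_le_geometric [NormedRing 𝓐] [NormedAlgebra ℝ 𝓐] {f : V → 𝓐}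
    (hf : ContDiff ℝ ∞ f) {x : V} {N : ℕ} {R : ℝ}
    (hfx : ∀ i ≤ N, ‖iteratedFDeriv ℝ i f x‖ ≤ R ^ i) (m : ℕ) :
    ∀ i ≤ N, ‖iteratedFDeriv ℝ i (fun y => f y ^ (m + 1)) x‖ ≤ (((m + 1 : ℕ) : ℝ) * R) ^ i := by
  induction m with
  | zero => simpa using hfx
  | succ m ih =>
    intro i hi
    have := norm_iteratedFDeriv_mul_le_geometric (hf.pow (m + 1)) hf (a := 1) (b := 1)
      (by simpa using ih) (by simpa using hfx) hi
    simp only [← pow_succ] at this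
    convert this using 1
    push_cast
    ring

theorem norm_iteratedFDeriv_prod_le_geometric {ι : Type} (s : Finset ι) {f : ι → V → ℂ}
    (hf : ∀ j, ContDiff ℝ ∞ (f j)) {x : V} {N : ℕ} {K R : ℝ}
    (hfx : ∀ j, ∀ i ≤ N, ‖iteratedFDeriv ℝ i (f j) x‖ ≤ K * R ^ i) :
    ∀ i ≤ N, ‖iteratedFDeriv ℝ i (fun y => ∏ j ∈ s, f j y) x‖ ≤ K ^ s.card * (s.card * R) ^ i := by
  classical
  induction s using Finset.induction_on with
  | empty =>
    intro i _
    rcases eq_or_ne i 0 with rfl | h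
    · simp
    · simp [iteratedFDeriv_const_of_ne h, h]
  | insert j s hj ih =>
    intro i hi
    have := norm_iteratedFDeriv_mul_le_geometric (hf j)
      (contDiff_prod fun k _ => hf k) (hfx j) ih hi
    simp only [Finset.prod_insert hj, Finset.card_insert_of_notMem hj]
    convert this using 1
    push_cast
    ring

theorem contDiff_integral_of_dominated {α : Type} [NormedAddCommGroup α] [NormedSpace ℝ α]
    [MeasurableSpace α] [BorelSpace α] [SecondCountableTopology α] {μ : Measure α}
    {W : Type} [NormedAddCommGroup W] [NormedSpace ℝ W] {f : α → V → W}
    (hf : ContDiff ℝ ∞ (Function.uncurry f))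
    (hb : ∀ (r : ℝ) (k : ℕ), ∃ b : α → ℝ, Integrable b μ ∧
      ∀ a v, ‖v‖ ≤ r → ‖iteratedFDeriv ℝ k (f a) v‖ ≤ b a) :
    ContDiff ℝ ∞ (fun v => ∫ a, f a v ∂μ) := by
  rw [contDiff_infty]
  intro m
  have deriv_integral : ∀ {W : Type} [NormedAddCommGroup W] [NormedSpace ℝ W] {f : α → V → W},
      ContDiff ℝ ∞ (Function.uncurry f) →
      (∀ (r : ℝ) (k : ℕ), ∃ b : α → ℝ, Integrable b μ ∧
        ∀ a v, ‖v‖ ≤ r → ‖iteratedFDeriv ℝ k (f a) v‖ ≤ b a) →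
      ∀ v, HasFDerivAt (fun v => ∫ a, f a v ∂μ) (∫ a, fderiv ℝ (f a) v ∂μ) v := by
    intro W _ _ f hf hb v
    have hfa : ∀ a, ContDiff ℝ ∞ (f a) := fun a => hf.comp (contDiff_prodMk_right a)
    have hmeas : ∀ v, AEStronglyMeasurable (fun a => f a v) μ := fun v =>
      (hf.continuous.comp (Continuous.prodMk_left v)).aestronglyMeasurable
    have hf' : ContDiff ℝ ∞ (Function.uncurry fun a v => fderiv ℝ (f a) v) :=
      ContDiff.fderiv (f := fun (p : α × V) v => f p.1 v) (g := Prod.snd)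
        (hf.comp (by fun_prop : ContDiff ℝ ∞ fun q : (α × V) × V => (q.1.1, q.2)))
        contDiff_snd (by simp)
    obtain ⟨b₀, hb₀, hb₀'⟩ := hb ‖v‖ 0
    obtain ⟨b₁, hb₁, hb₁'⟩ := hb (‖v‖ + 1) 1
    refine hasFDerivAt_integral_of_dominated_of_fderiv_le (Metric.ball_mem_nhds v one_pos)
      (.of_forall hmeas) (hb₀.mono' (hmeas v) (.of_forall fun a => ?_))
      (hf'.continuous.comp (Continuous.prodMk_left v)).aestronglyMeasurable
      (.of_forall fun a x hx => ?_) hb₁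
      (.of_forall fun a x _ => ((hfa a).differentiable (by simp) x).hasFDerivAt)
    · simpa using hb₀' a v le_rfl
    · have hx' : ‖x‖ ≤ ‖v‖ + 1 := by
        have h1 : ‖x - v‖ < 1 := mem_ball_iff_norm.1 hx
        have h2 := norm_le_norm_add_norm_sub v x
        rw [norm_sub_rev] at h2
        linarith
      have := hb₁' a x hx'
      rwa [← norm_iteratedFDeriv_fderiv, norm_iteratedFDeriv_zero] at this
  induction m generalizing W with
  | zero =>
    exact contDiff_zero.2 (continuous_iff_continuousAt.2 fun v =>
      (deriv_integral hf hb v).continuousAt)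
  | succ m ih =>
    have hf' : ContDiff ℝ ∞ (Function.uncurry fun a v => fderiv ℝ (f a) v) :=
      ContDiff.fderiv (f := fun (p : α × V) v => f p.1 v) (g := Prod.snd)
        (hf.comp (by fun_prop : ContDiff ℝ ∞ fun q : (α × V) × V => (q.1.1, q.2)))
        contDiff_snd (by simp)
    refine (contDiff_succ_iff_hasFDerivAt (n := m)).2
      ⟨_, ih hf' fun r k => ?_, fun v => deriv_integral hf hb v⟩
    obtain ⟨b, hb, hb'⟩ := hb r (k + 1)
    exact ⟨b, hb, fun a v hv => by simpa only [norm_iteratedFDeriv_fderiv] using hb' a v hv⟩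
end

theorem contDiff_exp_real {𝓐 : Type} [NormedRing 𝓐] [NormedAlgebra ℝ 𝓐] [CompleteSpace 𝓐] :
    ContDiff ℝ ∞ (NormedSpace.exp : 𝓐 → 𝓐) :=
  contDiff_iff_contDiffAt.2 fun x => (NormedSpace.exp_analytic (𝕂 := ℝ) x).contDiffAt

section
variable {V 𝓐 : Type} [NormedAddCommGroup V] [NormedSpace ℝ V] [CStarAlgebra 𝓐]

theorem norm_exp_smul_I_le_one {a : 𝓐} (ha : IsSelfAdjoint a) (t : ℝ) :
    ‖NormedSpace.exp (((t : ℂ) * Complex.I) • a)‖ ≤ 1 := by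
  rcases subsingleton_or_nontrivial 𝓐 with h | h
  · simp [Subsingleton.elim (NormedSpace.exp (((t : ℂ) * Complex.I) • a)) 0]
  · have := CStarRing.norm_coe_unitary
      (selfAdjoint.expUnitary ⟨t • a, (IsSelfAdjoint.all t).smul ha⟩)
    rw [selfAdjoint.expUnitary_coe] at this
    refine le_of_eq (Eq.trans ?_ this)
    congr 2
    simp only [mul_comm (t : ℂ), mul_smul, Complex.coe_smul]

theorem contDiff_exp_smul_I {E : Type} [NormedAddCommGroup E] [NormedSpace ℝ E]
    (Φ : V →L[ℝ] 𝓐) {t : E → ℝ} (ht : ContDiff ℝ ∞ t) :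
    ContDiff ℝ ∞ fun p : E × V =>
      NormedSpace.exp (((t p.1 : ℂ) * Complex.I) • Φ p.2) := by
  refine contDiff_exp_real.comp ?_
  have h : (fun p : E × V => ((t p.1 : ℂ) * Complex.I) • Φ p.2) =
      fun p : E × V => t p.1 • (Complex.I • Φ p.2) := by
    ext p
    rw [mul_smul, Complex.coe_smul]
  rw [h]
  exact (ht.comp contDiff_fst).smul
    ((Φ.contDiff.comp contDiff_snd).const_smul Complex.I)

theorem exists_norm_iteratedFDeriv_exp_le [FiniteDimensional ℝ V] (Φ : V →L[ℝ] 𝓐)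
    (hΦ : ∀ v, IsSelfAdjoint (Φ v)) (N : ℕ) (r : ℝ) :
    ∃ C : ℝ, 0 ≤ C ∧ ∀ (t : ℝ) (v : V), ‖v‖ ≤ r → ∀ i ≤ N,
      ‖iteratedFDeriv ℝ i (fun v => NormedSpace.exp (((t : ℂ) * Complex.I) • Φ v)) v‖ ≤
        (C * (|t| + 2)) ^ i := by
  have smooth : ∀ t : ℝ, ContDiff ℝ ∞ fun v =>
      NormedSpace.exp (((t : ℂ) * Complex.I) • Φ v) := fun t =>
    (contDiff_exp_smul_I Φ (contDiff_const (c := t))).comp (contDiff_prodMk_right (0 : ℝ))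
  have hbase : ∀ i : ℕ, ∃ c : ℝ, ∀ v : V, ‖v‖ ≤ r →
      ‖iteratedFDeriv ℝ i (fun v => NormedSpace.exp ((((1 : ℝ) : ℂ) * Complex.I) • Φ v)) v‖ ≤ c := by
    intro i
    obtain ⟨c, hc⟩ := (isCompact_closedBall (0 : V) r).exists_bound_of_continuousOn
      ((smooth 1).continuous_iteratedFDeriv (m := i) (mod_cast le_top)).continuousOn
    exact ⟨c, fun v hv => hc v (by simpa using hv)⟩
  choose c hc using hbase
  set C : ℝ := 1 + ∑ i ∈ Finset.range (N + 1), |c i| with hC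
  have hC1 : 1 ≤ C := by
    have : 0 ≤ ∑ i ∈ Finset.range (N + 1), |c i| := Finset.sum_nonneg fun _ _ => abs_nonneg _
    linarith
  have hsmall : ∀ s : ℝ, |s| ≤ 1 → ∀ v : V, ‖v‖ ≤ r → ∀ i ≤ N,
      ‖iteratedFDeriv ℝ i (fun v => NormedSpace.exp (((s : ℂ) * Complex.I) • Φ v)) v‖ ≤ C ^ i := by
    intro s hs v hv i hi
    rcases eq_or_ne i 0 with rfl | hi0
    · simpa using norm_exp_smul_I_le_one (hΦ v) s
    have hcomp : (fun v => NormedSpace.exp (((s : ℂ) * Complex.I) • Φ v)) =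
        (fun v => NormedSpace.exp ((((1 : ℝ) : ℂ) * Complex.I) • Φ v)) ∘
          (s • ContinuousLinearMap.id ℝ V) := by
      ext v
      simp only [Function.comp, _root_.smul_apply, ContinuousLinearMap.id_apply,
        map_smul, Complex.ofReal_one, one_mul, mul_smul, Complex.coe_smul]
      rw [smul_comm]
    have hnorm : ‖s • ContinuousLinearMap.id ℝ V‖ ≤ 1 := by
      rw [norm_smul, Real.norm_eq_abs]
      exact mul_le_one₀ hs (norm_nonneg _) ContinuousLinearMap.norm_id_le
    have hsv : ‖s • v‖ ≤ r := by
      rw [norm_smul, Real.norm_eq_abs]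
      exact (mul_le_of_le_one_left (norm_nonneg _) hs).trans hv
    rw [hcomp, ContinuousLinearMap.iteratedFDeriv_comp_right _ (smooth 1) v (mod_cast le_top)]
    refine (ContinuousMultilinearMap.norm_compContinuousLinearMap_le _ _).trans ?_
    calc _ ≤ C * 1 := by
          gcongr
          · refine (hc i _ (by simpa using hsv)).trans ((le_abs_self _).trans ?_)
            have := Finset.single_le_sum (f := fun i => |c i|) (fun _ _ => abs_nonneg _)
              (Finset.mem_range.2 (Nat.lt_succ_of_le hi))
            linarith
          · exact Finset.prod_le_one (fun _ _ => norm_nonneg _) fun _ _ => hnorm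
      _ ≤ C ^ i := by
          rw [mul_one]
          exact le_self_pow₀ hC1 hi0
  refine ⟨C, by linarith, fun t v hv i hi => ?_⟩
  set m : ℕ := ⌈|t|⌉₊ with hm
  have hm1 : |t| ≤ (m + 1 : ℕ) := (Nat.le_ceil _).trans (by simp [hm])
  have hm2 : ((m + 1 : ℕ) : ℝ) ≤ |t| + 2 := by
    have := Nat.ceil_lt_add_one (abs_nonneg t)
    push_cast
    linarith
  have hpos : (0 : ℝ) < (m + 1 : ℕ) := by positivity
  have hpow : (fun v => NormedSpace.exp (((t : ℂ) * Complex.I) • Φ v)) =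
      fun v => NormedSpace.exp ((((t / (m + 1 : ℕ) : ℝ) : ℂ) * Complex.I) • Φ v) ^ (m + 1) := by
    ext v
    let := NormedAlgebra.restrictScalars ℚ ℂ 𝓐
    rw [← NormedSpace.exp_nsmul, ← Nat.cast_smul_eq_nsmul ℂ, smul_smul]
    congr 2
    push_cast
    field_simp
  rw [hpow]
  refine (norm_iteratedFDeriv_pow_succ_le_geometric (smooth _)
    (hsmall (t / (m + 1 : ℕ)) ?_ v hv) m i hi).trans ?_
  · rw [abs_div, Nat.abs_cast]
    exact (div_le_one hpos).2 hm1
  · rw [mul_comm C]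
    gcongr

open scoped FourierTransform SchwartzMap in
theorem contDiff_integral_schwartz_mul_prod_exp [FiniteDimensional ℝ V] {n : ℕ} (Φ : V →L[ℝ] 𝓐)
    (hΦ : ∀ v, IsSelfAdjoint (Φ v)) (u : Fin n → 𝓐 →L[ℝ] ℂ)
    (g : 𝓢(EuclideanSpace ℝ (Fin n), ℂ)) :
    ContDiff ℝ ∞ fun v => ∫ ξ, g ξ *
      ∏ j, u j (NormedSpace.exp ((((2 * Real.pi * ξ j : ℝ) : ℂ) * Complex.I) • Φ v)) := by
  have hsmooth : ∀ j, ContDiff ℝ ∞ fun p : EuclideanSpace ℝ (Fin n) × V =>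
      u j (NormedSpace.exp ((((2 * Real.pi * p.1 j : ℝ) : ℂ) * Complex.I) • Φ p.2)) := fun j =>
    (u j).contDiff.comp (contDiff_exp_smul_I Φ (t := fun ξ : EuclideanSpace ℝ (Fin n) =>
      2 * Real.pi * ξ j) (by fun_prop))
  refine contDiff_integral_of_dominated ?_ fun r k => ?_
  · exact ((g.smooth ⊤).comp contDiff_fst).mul (contDiff_prod fun j _ => hsmooth j)
  obtain ⟨C, hC0, hC⟩ := exists_norm_iteratedFDeriv_exp_le Φ hΦ k r
  set K : ℝ := ∑ j, ‖u j‖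
  refine ⟨fun ξ => ‖g ξ‖ * (K ^ n * (n * (C * (2 * Real.pi * ‖ξ‖ + 2))) ^ k), ?_, ?_⟩
  · have hInt : ∀ l : ℕ, Integrable (fun ξ : EuclideanSpace ℝ (Fin n) => ‖ξ‖ ^ l * ‖g ξ‖) :=
      fun l => g.integrable_pow_mul volume l
    have : (fun ξ : EuclideanSpace ℝ (Fin n) =>
        ‖g ξ‖ * (K ^ n * (n * (C * (2 * Real.pi * ‖ξ‖ + 2))) ^ k)) =
        fun ξ => ∑ l ∈ Finset.range (k + 1),
          (K ^ n * (n * C) ^ k * ((2 * Real.pi) ^ l * 2 ^ (k - l) * (k.choose l : ℝ))) *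
            (‖ξ‖ ^ l * ‖g ξ‖) := by
      ext ξ
      rw [← mul_assoc (n : ℝ), mul_pow, add_pow, Finset.mul_sum, Finset.mul_sum, Finset.mul_sum]
      refine Finset.sum_congr rfl fun l _ => ?_
      rw [mul_pow _ ‖ξ‖]
      ring
    rw [this]
    exact integrable_finsetSum _ fun l _ => (hInt l).const_mul _
  · intro ξ v hv
    have hs : ∀ j, ContDiff ℝ ∞ fun v =>
        u j (NormedSpace.exp ((((2 * Real.pi * ξ j : ℝ) : ℂ) * Complex.I) • Φ v)) := fun j =>
      (hsmooth j).comp (contDiff_prodMk_right ξ)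
    have hsE : ∀ j, ContDiff ℝ ∞ fun v =>
        NormedSpace.exp ((((2 * Real.pi * ξ j : ℝ) : ℂ) * Complex.I) • Φ v) := fun j =>
      (contDiff_exp_smul_I Φ (contDiff_const (c := 2 * Real.pi * ξ j))).comp
        (contDiff_prodMk_right (0 : ℝ))
    have hterm : ∀ j, ∀ i ≤ k, ‖iteratedFDeriv ℝ i (fun v =>
        u j (NormedSpace.exp ((((2 * Real.pi * ξ j : ℝ) : ℂ) * Complex.I) • Φ v))) v‖ ≤
        K * (C * (2 * Real.pi * ‖ξ‖ + 2)) ^ i := by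
      intro j i hi
      refine ((u j).norm_iteratedFDeriv_comp_left (hsE j).contDiffAt (mod_cast le_top)).trans ?_
      gcongr
      · exact Finset.single_le_sum (f := fun j => ‖u j‖) (fun _ _ => norm_nonneg _)
          (Finset.mem_univ j)
      · refine (hC (2 * Real.pi * ξ j) v hv i hi).trans ?_
        have : |2 * Real.pi * ξ j| ≤ 2 * Real.pi * ‖ξ‖ := by
          rw [abs_mul, abs_of_pos Real.two_pi_pos]
          gcongr
          exact PiLp.norm_apply_le ξ j
        gcongr
    have hprod := norm_iteratedFDeriv_prod_le_geometric Finset.univ hs hterm k le_rfl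
    have hmul : (fun v => g ξ * ∏ j, u j (NormedSpace.exp
        ((((2 * Real.pi * ξ j : ℝ) : ℂ) * Complex.I) • Φ v))) = fun v => g ξ • ∏ j, u j
        (NormedSpace.exp ((((2 * Real.pi * ξ j : ℝ) : ℂ) * Complex.I) • Φ v)) := rfl
    rw [hmul, iteratedFDeriv_const_smul_apply' (((contDiff_prod fun j _ => hs j).of_le
      (mod_cast le_top)).contDiffAt), norm_smul]
    simpa using mul_le_mul_of_nonneg_left hprod (norm_nonneg (g ξ))
end

section
open Matrix

variable {n : ℕ}

theorem Matrix.IsHermitian.exp_smul_eq {A : Matrix (Fin n) (Fin n) ℂ} (hA : A.IsHermitian)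
    (c : ℂ) :
    NormedSpace.exp (c • A) = (hA.eigenvectorUnitary : Matrix (Fin n) (Fin n) ℂ) *
      diagonal (fun i => Complex.exp (c * hA.eigenvalues i)) *
      (hA.eigenvectorUnitary : Matrix (Fin n) (Fin n) ℂ)⁻¹ := by
  set U : Matrix (Fin n) (Fin n) ℂ := ↑hA.eigenvectorUnitary
  have hinv : U⁻¹ = star U := inv_eq_right_inv (Unitary.mul_star_self_of_mem
    hA.eigenvectorUnitary.2)
  have hU : IsUnit U := ⟨Unitary.toUnits hA.eigenvectorUnitary, rfl⟩
  have hspec : c • A = U * diagonal (fun i => c * (hA.eigenvalues i : ℂ)) * U⁻¹ := by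
    conv_lhs => rw [hA.spectral_theorem, Unitary.conjStarAlgAut_apply]
    rw [hinv, ← smul_mul_assoc, ← mul_smul_comm, ← diagonal_smul]
    rfl
  rw [hspec, Matrix.exp_conj _ _ hU, Matrix.exp_diagonal]
  congr 3
  ext i
  rw [Pi.coe_exp, ← Complex.exp_eq_exp_ℂ]

/-- `n!` times the mixed discriminant of a family of `n` matrices of size `n`. -/
noncomputable def mixedDiscr (M : Fin n → Matrix (Fin n) (Fin n) ℂ) : ℂ :=
  ∑ σ : Equiv.Perm (Fin n), ∑ τ : Equiv.Perm (Fin n),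
    ((σ.sign : ℤ) : ℂ) * ((τ.sign : ℤ) : ℂ) * ∏ j, M j (σ j) (τ j)

theorem mixedDiscr_transpose (M : Fin n → Matrix (Fin n) (Fin n) ℂ) :
    mixedDiscr (fun j => (M j)ᵀ) = mixedDiscr M := by
  unfold mixedDiscr
  rw [Finset.sum_comm]
  simp only [transpose_apply, mul_comm]

theorem mixedDiscr_eq_sum_det (M : Fin n → Matrix (Fin n) (Fin n) ℂ) :
    mixedDiscr M = ∑ σ : Equiv.Perm (Fin n),
      ((σ.sign : ℤ) : ℂ) * det (of fun j k => M j (σ j) k) := by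
  unfold mixedDiscr
  refine Finset.sum_congr rfl fun σ _ => ?_
  rw [← det_transpose, det_apply', Finset.mul_sum]
  simp only [transpose_apply, of_apply, mul_assoc]

theorem mixedDiscr_mul_right (M : Fin n → Matrix (Fin n) (Fin n) ℂ)
    (U : Matrix (Fin n) (Fin n) ℂ) :
    mixedDiscr (fun j => M j * U) = mixedDiscr M * det U := by
  rw [mixedDiscr_eq_sum_det, mixedDiscr_eq_sum_det, Finset.sum_mul]
  refine Finset.sum_congr rfl fun σ _ => ?_
  rw [mul_assoc, ← det_mul]
  rfl

theorem mixedDiscr_mul_left (M : Fin n → Matrix (Fin n) (Fin n) ℂ)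
    (U : Matrix (Fin n) (Fin n) ℂ) :
    mixedDiscr (fun j => U * M j) = det U * mixedDiscr M := by
  rw [← mixedDiscr_transpose]
  simp only [transpose_mul]
  rw [mixedDiscr_mul_right, mixedDiscr_transpose, det_transpose, mul_comm]

theorem mixedDiscr_diagonal (d : Fin n → Fin n → ℂ) :
    mixedDiscr (fun j => diagonal (d j)) = ∑ σ : Equiv.Perm (Fin n), ∏ j, d j (σ j) := by
  unfold mixedDiscr
  refine Finset.sum_congr rfl fun σ _ => ?_
  rw [Finset.sum_eq_single σ]
  · rcases Int.units_eq_one_or σ.sign with h | h <;> simp [h]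
  · intro τ _ hτ
    obtain ⟨j, hj⟩ : ∃ j, σ j ≠ τ j := by
      by_contra! h
      exact hτ (Equiv.ext h).symm
    exact mul_eq_zero_of_right _ (Finset.prod_eq_zero (Finset.mem_univ j) (diagonal_apply_ne _ hj))
  · simp

theorem mixedDiscr_exp_smul {A : Matrix (Fin n) (Fin n) ℂ} (hA : A.IsHermitian)
    (c : Fin n → ℂ) :
    mixedDiscr (fun j => NormedSpace.exp (c j • A)) =
      ∑ σ : Equiv.Perm (Fin n), ∏ j, Complex.exp (c j * hA.eigenvalues (σ j)) := by
  have hU : IsUnit (hA.eigenvectorUnitary : Matrix (Fin n) (Fin n) ℂ).det :=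
    (isUnit_iff_isUnit_det _).1 ⟨Unitary.toUnits hA.eigenvectorUnitary, rfl⟩
  simp only [hA.exp_smul_eq]
  rw [mixedDiscr_mul_right, mixedDiscr_mul_left, mixedDiscr_diagonal, mul_right_comm, ← det_mul,
    mul_nonsing_inv _ hU, det_one, one_mul]

/-- Hermitian matrices as operators on Euclidean space. -/
noncomputable def hermToCLM (n : ℕ) : selfAdjoint.submodule ℝ (Matrix (Fin n) (Fin n) ℂ) →L[ℝ]
    (EuclideanSpace ℂ (Fin n) →L[ℂ] EuclideanSpace ℂ (Fin n)) :=
  LinearMap.toContinuousLinearMap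
    (((toEuclideanCLM (n := Fin n) (𝕜 := ℂ)).toAlgEquiv.toLinearMap.restrictScalars ℝ) ∘ₗ
      (selfAdjoint.submodule ℝ (Matrix (Fin n) (Fin n) ℂ)).subtype)

theorem isSelfAdjoint_hermToCLM (A : selfAdjoint.submodule ℝ (Matrix (Fin n) (Fin n) ℂ)) :
    IsSelfAdjoint (hermToCLM n A) :=
  IsSelfAdjoint.map (show IsSelfAdjoint (A : Matrix (Fin n) (Fin n) ℂ) from A.2)
    (toEuclideanCLM (n := Fin n) (𝕜 := ℂ))

/-- The matrix entries of an operator on Euclidean space. -/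
noncomputable def clmEntry (i j : Fin n) :
    (EuclideanSpace ℂ (Fin n) →L[ℂ] EuclideanSpace ℂ (Fin n)) →L[ℝ] ℂ :=
  LinearMap.toContinuousLinearMap ((entryLinearMap ℂ ℂ i j ∘ₗ
    (toEuclideanCLM (n := Fin n) (𝕜 := ℂ)).symm.toAlgEquiv.toLinearMap).restrictScalars ℝ)

theorem clmEntry_exp_hermToCLM (A : selfAdjoint.submodule ℝ (Matrix (Fin n) (Fin n) ℂ)) (c : ℂ)
    (i j : Fin n) :
    clmEntry i j (NormedSpace.exp (c • hermToCLM n A)) =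
      NormedSpace.exp (c • (A : Matrix (Fin n) (Fin n) ℂ)) i j := by
  have hcont : Continuous (toEuclideanCLM (n := Fin n) (𝕜 := ℂ)).symm :=
    LinearMap.continuous_of_finiteDimensional
      (toEuclideanCLM (n := Fin n) (𝕜 := ℂ)).symm.toAlgEquiv.toLinearMap
  have h : (toEuclideanCLM (n := Fin n) (𝕜 := ℂ)).symm (NormedSpace.exp (c • hermToCLM n A)) =
      NormedSpace.exp ((toEuclideanCLM (n := Fin n) (𝕜 := ℂ)).symm (c • hermToCLM n A)) := by
    rw [NormedSpace.exp_eq_tsum ℂ, NormedSpace.exp_eq_tsum ℂ]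
    refine ((NormedSpace.expSeries_summable' (𝕂 := ℂ) (c • hermToCLM n A)).hasSum.map
      (toEuclideanCLM (n := Fin n) (𝕜 := ℂ)).symm hcont).tsum_eq.symm.trans ?_
    simp only [Function.comp_def, map_smul, map_pow]
  have h2 : (toEuclideanCLM (n := Fin n) (𝕜 := ℂ)).symm (c • hermToCLM n A) =
      c • (A : Matrix (Fin n) (Fin n) ℂ) := by
    rw [map_smul]
    congr 1
    exact (toEuclideanCLM (n := Fin n) (𝕜 := ℂ)).symm_apply_apply _
  rw [h2] at h
  exact congrFun (congrFun h i) j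

end

section
variable {n : ℕ}

theorem prod_exp_eq_exp_inner (ξ : EuclideanSpace ℝ (Fin n)) (x : Fin n → ℝ) :
    ∏ j, Complex.exp (((2 * Real.pi * ξ j : ℝ) : ℂ) * Complex.I * x j) =
      Complex.exp (((2 * Real.pi * inner ℝ ξ (WithLp.toLp 2 x) : ℝ) : ℂ) * Complex.I) := by
  rw [← Complex.exp_sum, PiLp.inner_apply]
  congr 1
  push_cast
  rw [Finset.mul_sum, Finset.sum_mul]
  refine Finset.sum_congr rfl fun j _ => ?_
  simp only [RCLike.inner_apply, conj_trivial]
  push_cast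
  ring

open scoped FourierTransform SchwartzMap in
theorem schwartz_eq_integral_prod_exp (g : 𝓢(EuclideanSpace ℝ (Fin n), ℂ)) (x : Fin n → ℝ) :
    g (WithLp.toLp 2 x) = ∫ ξ, (𝓕 g) ξ *
      ∏ j, Complex.exp (((2 * Real.pi * ξ j : ℝ) : ℂ) * Complex.I * x j) := by
  have h : 𝓕⁻ (𝓕 g) = g := FourierTransform.fourierInv_fourier_eq g
  conv_lhs => rw [← h, SchwartzMap.fourierInv_coe, Real.fourierInv_eq']
  refine integral_congr_ae (.of_forall fun ξ => ?_)
  simp only [smul_eq_mul, prod_exp_eq_exp_inner]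
  rw [mul_comm]

open scoped FourierTransform SchwartzMap in
theorem contDiff_sum_perm_schwartz_hermEigenvalues (g : 𝓢(EuclideanSpace ℝ (Fin n), ℂ)) :
    ContDiff ℝ ∞ fun A => ∑ σ : Equiv.Perm (Fin n),
      g (WithLp.toLp 2 (hermEigenvalues n A ∘ σ)) := by
  let c : EuclideanSpace ℝ (Fin n) → Fin n → ℂ := fun ξ j =>
    ((2 * Real.pi * ξ j : ℝ) : ℂ) * Complex.I
  have hccont : ∀ j, Continuous fun ξ => c ξ j := fun j => by fun_prop
  have hInt : ∀ h : EuclideanSpace ℝ (Fin n) → ℂ, Continuous h → (∃ K, ∀ ξ, ‖h ξ‖ ≤ K) →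
      Integrable fun ξ => (𝓕 g) ξ * h ξ := fun h hc ⟨K, hK⟩ =>
    (𝓕 g).integrable.mul_bdd (c := K) hc.aestronglyMeasurable (.of_forall hK)
  have hexp : ∀ A : selfAdjoint.submodule ℝ (Matrix (Fin n) (Fin n) ℂ),
      ∀ σ τ : Equiv.Perm (Fin n), Integrable fun ξ => (𝓕 g) ξ *
        ∏ j, clmEntry (σ j) (τ j) (NormedSpace.exp (c ξ j • hermToCLM n A)) := by
    intro A σ τ
    refine hInt _ (continuous_finsetProd _ fun j _ => (clmEntry _ _).continuous.comp
      ((contDiff_exp_real (𝓐 := EuclideanSpace ℂ (Fin n) →L[ℂ] EuclideanSpace ℂ (Fin n))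
        ).continuous.comp ((hccont j).smul continuous_const)))
      ⟨∏ j, ‖clmEntry (σ j) (τ j)‖ * 1, fun ξ => ?_⟩
    rw [norm_prod]
    exact Finset.prod_le_prod (fun _ _ => norm_nonneg _) fun j _ =>
      (clmEntry (σ j) (τ j)).le_opNorm_of_le
        (norm_exp_smul_I_le_one (isSelfAdjoint_hermToCLM A) _)
  have hcexp : ∀ x : Fin n → ℝ, Integrable fun ξ => (𝓕 g) ξ *
      ∏ j, Complex.exp (c ξ j * x j) := by
    intro x
    refine hInt _ (continuous_finsetProd _ fun j _ => Complex.continuous_exp.comp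
      ((hccont j).mul continuous_const)) ⟨1, fun ξ => ?_⟩
    simp only [c, prod_exp_eq_exp_inner, Complex.norm_exp_ofReal_mul_I, le_refl]
  have key : (fun A => ∑ σ : Equiv.Perm (Fin n),
      g (WithLp.toLp 2 (hermEigenvalues n A ∘ σ))) =
      fun A => ∑ σ : Equiv.Perm (Fin n), ∑ τ : Equiv.Perm (Fin n),
        (((σ.sign : ℤ) : ℂ) * ((τ.sign : ℤ) : ℂ)) * ∫ ξ, (𝓕 g) ξ *
          ∏ j, clmEntry (σ j) (τ j) (NormedSpace.exp (c ξ j • hermToCLM n A)) := by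
    ext A
    simp only [schwartz_eq_integral_prod_exp]
    refine (integral_finsetSum _ fun (σ : Equiv.Perm (Fin n)) _ =>
      hcexp (hermEigenvalues n A ∘ σ)).symm.trans ?_
    simp only [← integral_const_mul]
    have hτ : ∀ σ : Equiv.Perm (Fin n), _ := fun σ =>
      integral_finsetSum (μ := volume) Finset.univ fun (τ : Equiv.Perm (Fin n)) _ =>
        (hexp A σ τ).const_mul (((σ.sign : ℤ) : ℂ) * ((τ.sign : ℤ) : ℂ))
    simp only [← hτ]
    rw [← integral_finsetSum _ fun σ _ => integrable_finsetSum _ fun τ _ =>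
      (hexp A σ τ).const_mul (((σ.sign : ℤ) : ℂ) * ((τ.sign : ℤ) : ℂ))]
    refine integral_congr_ae (.of_forall fun ξ => ?_)
    have h := mixedDiscr_exp_smul
      (show (A : Matrix (Fin n) (Fin n) ℂ).IsHermitian from A.2) (c ξ)
    simp only [clmEntry_exp_hermToCLM]
    calc _ = (𝓕 g) ξ * mixedDiscr fun j =>
          NormedSpace.exp (c ξ j • (A : Matrix (Fin n) (Fin n) ℂ)) := by
          rw [h, Finset.mul_sum]
          rfl
      _ = _ := by
          simp only [mixedDiscr, Finset.mul_sum]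
          exact Finset.sum_congr rfl fun σ _ => Finset.sum_congr rfl fun τ _ => by ring
  rw [key]
  exact ContDiff.sum fun σ _ => ContDiff.sum fun τ _ => contDiff_const.mul
    (contDiff_integral_schwartz_mul_prod_exp (hermToCLM n) isSelfAdjoint_hermToCLM
      (fun j => clmEntry (σ j) (τ j)) (𝓕 g))

theorem contDiff_sum_perm_hermEigenvalues {φ : (Fin n → ℝ) → ℝ} (hφ : ContDiff ℝ ∞ φ)
    (hsupp : HasCompactSupport φ) :
    ContDiff ℝ ∞ fun A => ∑ σ : Equiv.Perm (Fin n), φ (hermEigenvalues n A ∘ σ) := by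
  let e := EuclideanSpace.equiv (Fin n) ℝ
  have hs : HasCompactSupport fun x : EuclideanSpace ℝ (Fin n) => (φ (e x) : ℂ) :=
    (hsupp.comp_homeomorph e.toHomeomorph).comp_left (g := Complex.ofReal) Complex.ofReal_zero
  have hd : ContDiff ℝ ∞ fun x : EuclideanSpace ℝ (Fin n) => (φ (e x) : ℂ) :=
    Complex.ofRealCLM.contDiff.comp (hφ.comp e.contDiff)
  have h := Complex.reCLM.contDiff.comp
    (contDiff_sum_perm_schwartz_hermEigenvalues (hs.toSchwartzMap hd))
  convert h using 2 with A
  simp only [Function.comp_apply, Complex.reCLM_apply, Complex.re_sum]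
  rfl

theorem contDiff_mul_of_tsupport_subset {E : Type} [NormedAddCommGroup E] [NormedSpace ℝ E]
    {Γ : Set E} (hΓ : IsOpen Γ) {χ f : E → ℝ} (hχ : ContDiff ℝ ∞ χ) (hf : ContDiffOn ℝ ∞ f Γ)
    (hsub : tsupport χ ⊆ Γ) : ContDiff ℝ ∞ fun x => χ x * f x := by
  refine contDiff_iff_contDiffAt.2 fun x => ?_
  by_cases hx : x ∈ tsupport χ
  · exact hχ.contDiffAt.mul (hf.contDiffAt (hΓ.mem_nhds (hsub hx)))
  · refine (contDiffAt_const (c := (0 : ℝ))).congr_of_eventuallyEq ?_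
    filter_upwards [notMem_tsupport_iff_eventuallyEq.1 hx] with y hy
    simp only [hy, Pi.zero_apply, zero_mul]

theorem contDiffAt_comp_hermEigenvalues {Γ : Set (Fin n → ℝ)} (hΓ : IsOpen Γ)
    (hperm : ∀ π : Equiv.Perm (Fin n), ∀ x ∈ Γ, x ∘ π ∈ Γ) {f : (Fin n → ℝ) → ℝ}
    (hf : ContDiffOn ℝ ∞ f Γ) (hfsymm : ∀ π : Equiv.Perm (Fin n), ∀ x ∈ Γ, f (x ∘ π) = f x)
    {A : selfAdjoint.submodule ℝ (Matrix (Fin n) (Fin n) ℂ)} (hA : hermEigenvalues n A ∈ Γ) :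
    (∀ᶠ B in 𝓝 A, hermEigenvalues n B ∈ Γ) ∧
      ContDiffAt ℝ ∞ (fun B => f (hermEigenvalues n B)) A := by
  obtain ⟨χ, hsub, hcomp, hχ, hrange, hone⟩ :=
    exists_contDiff_tsupport_subset (n := ⊤) (hΓ.mem_nhds hA)
  have hnonneg : ∀ x, 0 ≤ χ x := fun x => (hrange ⟨x, rfl⟩).1
  have hG := contDiff_sum_perm_hermEigenvalues hχ hcomp
  have hH := contDiff_sum_perm_hermEigenvalues
    (contDiff_mul_of_tsupport_subset hΓ hχ hf hsub) hcomp.mul_right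
  have hpos : 0 < ∑ σ : Equiv.Perm (Fin n), χ (hermEigenvalues n A ∘ σ) :=
    Finset.sum_pos' (fun _ _ => hnonneg _) ⟨1, Finset.mem_univ _, by
      simp only [Equiv.Perm.coe_one, Function.comp_id, hone, zero_lt_one]⟩
  have hpos' := hG.continuous.continuousAt.eventually_const_lt hpos
  have hmem : ∀ᶠ B in 𝓝 A, hermEigenvalues n B ∈ Γ := by
    filter_upwards [hpos'] with B hB
    obtain ⟨σ, -, hσ⟩ := Finset.exists_ne_zero_of_sum_ne_zero hB.ne'
    simpa only [Function.comp_assoc, Equiv.self_comp_symm, Function.comp_id] using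
      hperm σ.symm _ (hsub (subset_tsupport χ hσ))
  refine ⟨hmem, (hH.contDiffAt.div hG.contDiffAt hpos.ne').congr_of_eventuallyEq ?_⟩
  filter_upwards [hpos', hmem] with B hB hBΓ
  rw [Pi.div_apply, eq_div_iff hB.ne', Finset.mul_sum]
  exact Finset.sum_congr rfl fun σ _ => by rw [hfsymm σ _ hBΓ, mul_comm]

end

end

/-- smoothness of spectral functions. Let `Γ ⊆ ℝⁿ` be open and invariant
under permutations of coordinates, and let `f : Γ → ℝ` be a smooth symmetric function.  Then
the spectral function `F(A) := f(λ(A))` is a smooth function on the open subset of the real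
vector space of Hermitian `n×n` matrices consisting of those matrices whose eigenvalue
vector lies in `Γ`. -/
theorem stmt_19 (n : ℕ) (Γ : Set (Fin n → ℝ)) (hopen : IsOpen Γ)
    (hperm : ∀ π : Equiv.Perm (Fin n), ∀ x ∈ Γ, (x ∘ π) ∈ Γ)
    (f : (Fin n → ℝ) → ℝ)
    (hf : ContDiffOn ℝ (⊤ : ℕ∞) f Γ)
    (hfsymm : ∀ π : Equiv.Perm (Fin n), ∀ x ∈ Γ, f (x ∘ π) = f x) :
    IsOpen {A : selfAdjoint.submodule ℝ (Matrix (Fin n) (Fin n) ℂ) |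
        hermEigenvalues n A ∈ Γ} ∧
    ContDiffOn ℝ (⊤ : ℕ∞)
      (fun A : selfAdjoint.submodule ℝ (Matrix (Fin n) (Fin n) ℂ) =>
        f (hermEigenvalues n A))
      {A : selfAdjoint.submodule ℝ (Matrix (Fin n) (Fin n) ℂ) |
        hermEigenvalues n A ∈ Γ} := by
  have h := fun A (hA : hermEigenvalues n A ∈ Γ) =>
    contDiffAt_comp_hermEigenvalues hopen hperm hf hfsymm hA
  exact ⟨isOpen_iff_mem_nhds.2 fun A hA => (h A hA).1, fun A hA => (h A hA).2.contDiffWithinAt⟩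
end
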